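/- arXiv:2312.16004 — 2 statements merged into one kernel-verified Lean document; each statement's English description precedes it below -/
import Mathlib

section
/- Let λ, c, δ > 0 and α ≥ 0. Let μ be a Borel probability measure on [0,∞) with μ({0}) = 0 whose distribution function F(x) = μ([0,x]) is continuous, and let A : [0,∞) → [0,∞) be continuous. Suppose Φ : [0,∞) → ℝ is continuous and bounded, suppose ∫_u^∞ (δy + c)^{−(λ+α)/δ − 1} A(y) dy < ∞ for all u ≥ 0, and suppose that for all u ≥ 0: Φ(u) = λ (δu + c)^{(λ+α)/δ} ∫_u^∞ (δy + c)^{−(λ+α)/δ − 1} ( ∫_{[0,y]} Φ(y−x) dμ(x) + A(y) ) dy. Then Φ is continuously differentiable on [0,∞) (with a one-sided derivative at 0) and for all u ≥ 0: Φ′(u) = ((λ+α)/(c + δu)) Φ(u) − (λ/(c + δu)) ( ∫_{[0,u]} Φ(u−x) dμ(x) + A(u) ). -/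
open MeasureTheory Set intervalIntegral Real

/-- A finite measure vanishing on `(-∞, 0)` with `μ {0} = 0` and continuous distribution function
has no atoms. -/
theorem measure_singleton_eq_zero_of_continuous_cdf (μ : Measure ℝ) [IsFiniteMeasure μ]
    (hμsupp : μ (Iio 0) = 0) (hμ0 : μ {0} = 0)
    (hF : Continuous fun x => (μ (Icc 0 x)).toReal) (a : ℝ) : μ {a} = 0 := by
  rcases lt_trichotomy a 0 with ha | rfl | ha
  · exact measure_mono_null (singleton_subset_iff.2 ha) hμsupp
  · exact hμ0
  have hle : ∀ b < a, μ.real {a} ≤ (μ (Icc 0 a)).toReal - (μ (Icc 0 b)).toReal := by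
    intro b hb
    have hdisj : Disjoint (Icc 0 b) {a} := by
      rw [Set.disjoint_singleton_right]
      exact fun h => absurd h.2 (not_le.2 hb)
    have hunion := measureReal_union (μ := μ) hdisj (measurableSet_singleton a)
    have hsub : μ.real (Icc 0 b ∪ {a}) ≤ μ.real (Icc 0 a) := by
      refine measureReal_mono (union_subset (Icc_subset_Icc_right hb.le) ?_)
      exact singleton_subset_iff.2 ⟨ha.le, le_rfl⟩
    simp only [Measure.real] at *
    linarith
  have hlim : Filter.Tendsto (fun b => (μ (Icc 0 a)).toReal - (μ (Icc 0 b)).toReal)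
      (nhdsWithin a (Iio a)) (nhds 0) := by
    have h := (hF.tendsto a).const_sub (μ (Icc 0 a)).toReal
    rw [sub_self] at h
    exact h.mono_left nhdsWithin_le_nhds
  have h0 : μ.real {a} ≤ 0 :=
    ge_of_tendsto hlim (by filter_upwards [self_mem_nhdsWithin] with b hb using hle b hb)
  exact (measureReal_eq_zero_iff).1 (le_antisymm h0 measureReal_nonneg)

/-- The convolution of a bounded continuous function with an atomless finite measure over
`[0, y]` is continuous in `y`. -/
theorem continuous_setIntegral_Icc_comp_sub (μ : Measure ℝ) [IsFiniteMeasure μ]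
    (hμ : ∀ a, μ {a} = 0) {Ψ : ℝ → ℝ} (hΨ : Continuous Ψ) {M : ℝ} (hM : ∀ u, |Ψ u| ≤ M) :
    Continuous fun y => ∫ x in Icc 0 y, Ψ (y - x) ∂μ := by
  have hind : ∀ y, ∫ x in Icc 0 y, Ψ (y - x) ∂μ =
      ∫ x, (Icc 0 y).indicator (fun x => Ψ (y - x)) x ∂μ :=
    fun y => (MeasureTheory.integral_indicator measurableSet_Icc).symm
  simp only [hind]
  rw [continuous_iff_continuousAt]
  intro y₀
  refine continuousAt_of_dominated (bound := fun _ => M) ?_ ?_ (integrable_const M) ?_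
  · refine Filter.Eventually.of_forall fun y => ?_
    exact ((hΨ.comp (continuous_const.sub continuous_id)).measurable.indicator
      measurableSet_Icc).aestronglyMeasurable
  · refine Filter.Eventually.of_forall fun y => Filter.Eventually.of_forall fun x => ?_
    exact (norm_indicator_le_norm_self _ _).trans (hM _)
  · have hne : ∀ᵐ x ∂μ, x ≠ y₀ := by
      rw [ae_iff]
      simpa using hμ y₀
    filter_upwards [hne] with x hx
    have hcont : ContinuousAt (fun y => Ψ (y - x)) y₀ :=
      (hΨ.comp (continuous_id.sub continuous_const)).continuousAt
    by_cases hx0 : 0 ≤ x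
    · rcases lt_or_gt_of_ne hx with h | h
      · refine hcont.congr ?_
        filter_upwards [lt_mem_nhds h] with y hy
        rw [indicator_of_mem (show x ∈ Icc 0 y from ⟨hx0, hy.le⟩)]
      · refine (continuousAt_const (y := (0 : ℝ))).congr ?_
        filter_upwards [gt_mem_nhds h] with y hy
        rw [indicator_of_notMem (fun hxy => absurd hxy.2 (not_le.2 hy))]
    · refine (continuousAt_const (y := (0 : ℝ))).congr (Filter.Eventually.of_forall fun y => ?_)
      simp only
      rw [indicator_of_notMem (fun hxy => hx0 hxy.1)]

theorem integrableOn_Ici_mul_add_rpow {δ c r : ℝ} (hδ : 0 < δ) (hc : 0 < c) (hr : r < -1) :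
    IntegrableOn (fun y => (δ * y + c) ^ r) (Ici 0) := by
  rw [integrableOn_Ici_iff_integrableOn_Ioi]
  have h := integrableOn_add_rpow_Ioi_of_lt (c := 0) (m := c) hr (by linarith)
  have h' := (integrableOn_Ioi_comp_mul_left_iff (fun x : ℝ => (x + c) ^ r) 0 hδ).2
    (by simpa using h)
  exact h'

/-- If `k` is integrable and continuous on `[0, ∞)`, its tail integral has derivative `-k`. -/
theorem hasDerivWithinAt_setIntegral_Ici {k : ℝ → ℝ} (hk : ContinuousOn k (Ici 0))
    (hint : IntegrableOn k (Ici 0)) {u : ℝ} (hu : 0 ≤ u) :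
    HasDerivWithinAt (fun v => ∫ y in Ici v, k y) (-k u) (Ici 0) u := by
  have hK : Continuous fun y => k (max y 0) :=
    hk.comp_continuous (continuous_id.max continuous_const) fun y => le_max_right y 0
  have hd : HasDerivAt (fun v => (∫ y in Ici 0, k y) - ∫ y in (0 : ℝ)..v, k (max y 0))
      (-k (max u 0)) u :=
    (integral_hasDerivAt_right (hK.intervalIntegrable 0 u)
      (hK.stronglyMeasurableAtFilter _ _) hK.continuousAt).const_sub _
  rw [max_eq_left hu] at hd
  have heq : ∀ v ∈ Ici (0 : ℝ), ∫ y in Ici v, k y =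
      (∫ y in Ici 0, k y) - ∫ y in (0 : ℝ)..v, k (max y 0) := by
    intro v hv
    have hv' : (0 : ℝ) ≤ v := hv
    have hcongr : ∫ y in (0 : ℝ)..v, k (max y 0) = ∫ y in (0 : ℝ)..v, k y := by
      refine integral_congr fun y hy => ?_
      rw [uIcc_of_le hv'] at hy
      simp only [max_eq_left hy.1]
    have hsplit := integral_interval_add_Ioi (f := k) (μ := volume) (a := 0) (b := v)
      (hint.mono_set Ioi_subset_Ici_self)
      (hint.mono_set fun y hy => hv'.trans (le_of_lt hy))
    rw [hcongr, integral_Ici_eq_integral_Ioi, integral_Ici_eq_integral_Ioi]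
    linarith
  exact hd.hasDerivWithinAt.congr heq (heq u hu)

/-- Let `λ, c, δ > 0`, `α ≥ 0`, let `μ` be a Borel probability measure
supported on `[0,∞)` with `μ({0}) = 0` and continuous distribution function
`F(x) = μ([0,x])`, and let `A : [0,∞) → [0,∞)` be continuous. If `Φ` is continuous and
bounded on `[0,∞)`, the improper integrals below converge, and
`Φ(u) = λ (δu + c)^{(λ+α)/δ} ∫_u^∞ (δy + c)^{−(λ+α)/δ − 1} ( ∫_{[0,y]} Φ(y−x) dμ(x) + A(y) ) dy`
for all `u ≥ 0`, then `Φ` is continuously differentiable on `[0,∞)` (one-sided at `0`)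
with `Φ′(u) = ((λ+α)/(c+δu)) Φ(u) − (λ/(c+δu)) ( ∫_{[0,u]} Φ(u−x) dμ(x) + A(u) )`. -/
theorem gerber_shiu_integro_differential
    (lam c δ α : ℝ) (hlam : 0 < lam) (hc : 0 < c) (hδ : 0 < δ) (hα : 0 ≤ α)
    (μ : Measure ℝ) [IsProbabilityMeasure μ]
    (hμsupp : μ (Iio 0) = 0) (hμ0 : μ {0} = 0)
    (hF : Continuous fun x => (μ (Icc 0 x)).toReal)
    (A : ℝ → ℝ) (hA : ContinuousOn A (Ici 0)) (hApos : ∀ t ∈ Ici (0 : ℝ), 0 ≤ A t)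
    (Φ : ℝ → ℝ) (hΦcont : ContinuousOn Φ (Ici 0))
    (hΦbdd : ∃ M : ℝ, ∀ u ∈ Ici (0 : ℝ), |Φ u| ≤ M)
    (hInt : ∀ u ∈ Ici (0 : ℝ),
      IntegrableOn (fun y => (δ * y + c) ^ (-(lam + α) / δ - 1) * A y) (Ici u))
    (hΦeq : ∀ u ∈ Ici (0 : ℝ),
      Φ u = lam * (δ * u + c) ^ ((lam + α) / δ) *
        ∫ y in Ici u, (δ * y + c) ^ (-(lam + α) / δ - 1) *
          ((∫ x in Icc 0 y, Φ (y - x) ∂μ) + A y)) :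
    ∃ Φ' : ℝ → ℝ, ContinuousOn Φ' (Ici 0) ∧
      ∀ u ∈ Ici (0 : ℝ),
        HasDerivWithinAt Φ (Φ' u) (Ici 0) u ∧
        Φ' u = ((lam + α) / (c + δ * u)) * Φ u -
          (lam / (c + δ * u)) * ((∫ x in Icc 0 u, Φ (u - x) ∂μ) + A u) := by
  obtain ⟨M, hM⟩ := hΦbdd
  have hpos : ∀ u ∈ Ici (0 : ℝ), 0 < δ * u + c := fun u hu =>
    add_pos_of_nonneg_of_pos (mul_nonneg hδ.le hu) hc
  have hatom := measure_singleton_eq_zero_of_continuous_cdf μ hμsupp hμ0 hF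
  have hΨ : Continuous fun u => Φ (max u 0) :=
    hΦcont.comp_continuous (continuous_id.max continuous_const) fun u => le_max_right u 0
  have hg : Continuous fun y => ∫ x in Icc 0 y, Φ (y - x) ∂μ := by
    have h := continuous_setIntegral_Icc_comp_sub μ hatom hΨ (fun u => hM _ (le_max_right u 0))
    refine h.congr fun y => setIntegral_congr_fun measurableSet_Icc fun x hx => ?_
    simp only [max_eq_left (sub_nonneg.2 hx.2)]
  have hgM : ∀ y, ‖∫ x in Icc 0 y, Φ (y - x) ∂μ‖ ≤ M := by
    intro y
    have hM0 : 0 ≤ M := (abs_nonneg _).trans (hM 0 self_mem_Ici)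
    refine (norm_setIntegral_le_of_norm_le_const (measure_lt_top μ _)
      fun x hx => hM _ (sub_nonneg.2 hx.2)).trans ?_
    exact mul_le_of_le_one_right hM0 measureReal_le_one
  set g : ℝ → ℝ := fun y => ∫ x in Icc 0 y, Φ (y - x) ∂μ
  have hrcont : ContinuousOn (fun y => (δ * y + c) ^ (-(lam + α) / δ - 1)) (Ici 0) :=
    ContinuousOn.rpow_const (by fun_prop) fun y hy => Or.inl (hpos y hy).ne'
  have hkcont : ContinuousOn (fun y => (δ * y + c) ^ (-(lam + α) / δ - 1) * (g y + A y))
      (Ici 0) := hrcont.mul (hg.continuousOn.add hA)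
  have hexp : -(lam + α) / δ - 1 < -1 := by
    have : 0 < (lam + α) / δ := by positivity
    rw [neg_div]
    linarith
  have hkint : IntegrableOn (fun y => (δ * y + c) ^ (-(lam + α) / δ - 1) * (g y + A y))
      (Ici 0) := by
    simp only [mul_add]
    refine Integrable.add ?_ (hInt 0 self_mem_Ici)
    exact (integrableOn_Ici_mul_add_rpow hδ hc hexp).mul_bdd
      hg.aestronglyMeasurable (Filter.Eventually.of_forall hgM)
  refine ⟨fun u => ((lam + α) / (c + δ * u)) * Φ u - (lam / (c + δ * u)) * (g u + A u),
    ?_, fun u hu => ⟨?_, rfl⟩⟩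
  · have hne : ∀ u ∈ Ici (0 : ℝ), c + δ * u ≠ 0 := fun u hu => by
      rw [add_comm]
      exact (hpos u hu).ne'
    have hden : ContinuousOn (fun u => c + δ * u) (Ici 0) := by fun_prop
    exact ((continuousOn_const.div hden hne).mul hΦcont).sub
      ((continuousOn_const.div hden hne).mul (hg.continuousOn.add hA))
  · have hp := hpos u hu
    have hlin : HasDerivAt (fun v => δ * v + c) δ u := by
      simpa using ((hasDerivAt_id u).const_mul δ).add_const c
    have hpow := ((hlin.rpow_const (p := (lam + α) / δ) (Or.inl hp.ne')).const_mul
      lam).hasDerivWithinAt (s := Ici 0)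
    have hd := (hpow.mul (hasDerivWithinAt_setIntegral_Ici hkcont hkint hu)).congr
      hΦeq (hΦeq u hu)
    refine hd.congr_deriv ?_
    have hΦu : Φ u = lam * (δ * u + c) ^ ((lam + α) / δ) *
        ∫ y in Ici u, (δ * y + c) ^ (-(lam + α) / δ - 1) * (g y + A y) := hΦeq u hu
    simp only [hΦu]
    generalize ∫ y in Ici u, (δ * y + c) ^ (-(lam + α) / δ - 1) * (g y + A y) = J
    rw [add_comm c (δ * u), rpow_sub_one hp.ne', rpow_sub_one hp.ne', neg_div,
      rpow_neg hp.le]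
    have hpw : (δ * u + c) ^ ((lam + α) / δ) ≠ 0 := (rpow_pos_of_pos hp _).ne'
    field_simp
    ring
end

section
/- Let λ, c, δ > 0 and α ≥ 0. Let μ be a Borel probability measure on [0,∞) with μ({0}) = 0 whose distribution function F(x) = μ([0,x]) is continuous, and let A : [0,∞) → [0,∞) be continuous. Suppose Φ : [0,∞) → ℝ is continuous, continuously differentiable on (0,∞), and satisfies for all u > 0: Φ′(u) = ((λ+α)/(c + δu)) Φ(u) − (λ/(c + δu)) ( ∫_{[0,u]} Φ(u−x) dμ(x) + A(u) ). Then Φ satisfies the second-kind Volterra integral equation: for all u ≥ 0, Φ(u) = c Φ(0)/(c + δu) − (λ/(c + δu)) ∫₀^u A(t) dt + ∫₀^u K_{δ,α}(u,t) Φ(t) dt, where K_{δ,α}(u,t) = (δ + α + λ(1 − F(u−t)))/(c + δu). -/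
open MeasureTheory Set intervalIntegral

/-- For a finite measure `μ` on `[0,∞)` and `Φ` continuous on `[0,u]`, the convolution
`s ↦ ∫_{[0,s]} Φ(s-x) dμ(x)` is integrable on `[0,u]`, and its integral is the convolution of `Φ`
with the distribution function of `μ`. -/
theorem integrableOn_and_integral_convolution (μ : Measure ℝ) [IsFiniteMeasure μ]
    (hμ : μ (Iio 0) = 0) {Φ : ℝ → ℝ} {u : ℝ} (hΦ : ContinuousOn Φ (Icc 0 u)) :
    IntegrableOn (fun s => ∫ x in Icc 0 s, Φ (s - x) ∂μ) (Icc 0 u) ∧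
      ∫ s in Icc 0 u, (∫ x in Icc 0 s, Φ (s - x) ∂μ) =
        ∫ t in Icc 0 u, (μ (Icc 0 (u - t))).toReal * Φ t := by
  have hnn : ∀ᵐ x ∂μ, 0 ≤ x := by
    rw [ae_iff]
    simpa [Iio] using hμ
  set Ψ : ℝ → ℝ := (Icc 0 u).indicator Φ with hΨ
  have hΨm : Measurable Ψ := by
    rw [hΨ, ← Set.piecewise_eq_indicator]
    exact hΦ.measurable_piecewise continuousOn_const measurableSet_Icc
  obtain ⟨M, hM⟩ := isCompact_Icc.exists_bound_of_continuousOn hΦ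
  have hΨM : ∀ t, ‖Ψ t‖ ≤ max M 0 := by
    intro t
    by_cases ht : t ∈ Icc 0 u
    · rw [hΨ, indicator_of_mem ht]
      exact (hM t ht).trans (le_max_left _ _)
    · rw [hΨ, indicator_of_notMem ht, norm_zero]
      exact le_max_right _ _
  have hconv : ∀ s ∈ Icc 0 u, ∫ x in Icc 0 s, Φ (s - x) ∂μ = ∫ x, Ψ (s - x) ∂μ := by
    intro s hs
    rw [← MeasureTheory.integral_indicator measurableSet_Icc]
    refine integral_congr_ae ?_
    filter_upwards [hnn] with x hx
    simp only [hΨ, indicator_apply, mem_Icc]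
    refine if_congr ⟨fun h => ⟨by linarith, by linarith [hs.2]⟩, fun h => ⟨hx, by linarith⟩⟩ rfl rfl
  have hint : Integrable (fun p : ℝ × ℝ => Ψ (p.1 - p.2))
      ((volume.restrict (Icc 0 u)).prod μ) :=
    Integrable.of_bound (hΨm.comp (measurable_fst.sub measurable_snd)).aestronglyMeasurable
      (max M 0) (.of_forall fun p => hΨM _)
  set D : Set (ℝ × ℝ) := {p | 0 ≤ p.2 ∧ p.2 ≤ u - p.1} with hD
  have hDm : MeasurableSet D :=
    (measurableSet_le measurable_const measurable_snd).inter
      (measurableSet_le measurable_snd (measurable_const.sub measurable_fst))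
  have hint' : Integrable (D.indicator fun p : ℝ × ℝ => Ψ p.1)
      ((volume.restrict (Icc 0 u)).prod μ) :=
    (Integrable.of_bound (hΨm.comp measurable_fst).aestronglyMeasurable
      (max M 0) (.of_forall fun p => hΨM _)).indicator hDm
  refine ⟨IntegrableOn.congr_fun hint.integral_prod_left (fun s hs => (hconv s hs).symm)
    measurableSet_Icc, ?_⟩
  calc ∫ s in Icc 0 u, (∫ x in Icc 0 s, Φ (s - x) ∂μ)
      = ∫ s in Icc 0 u, ∫ x, Ψ (s - x) ∂μ := setIntegral_congr_fun measurableSet_Icc hconv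
    _ = ∫ x, (∫ s in Icc 0 u, Ψ (s - x)) ∂μ := integral_integral_swap hint
    _ = ∫ x, (∫ t in Icc 0 u, D.indicator (fun p : ℝ × ℝ => Ψ p.1) (t, x)) ∂μ := by
      refine integral_congr_ae ?_
      filter_upwards [hnn] with x hx
      rw [← MeasureTheory.integral_indicator measurableSet_Icc, ← MeasureTheory.integral_indicator measurableSet_Icc,
        ← integral_add_right_eq_self _ x]
      congr 1
      ext t
      simp only [hΨ, hD, indicator_apply, mem_Icc, mem_ofPred_eq, add_sub_cancel_right]
      grind
    _ = ∫ t in Icc 0 u, ∫ x, D.indicator (fun p : ℝ × ℝ => Ψ p.1) (t, x) ∂μ :=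
      (integral_integral_swap (f := fun t x => D.indicator (fun p : ℝ × ℝ => Ψ p.1) (t, x))
        hint').symm
    _ = ∫ t in Icc 0 u, (μ (Icc 0 (u - t))).toReal * Φ t := by
      refine setIntegral_congr_fun measurableSet_Icc fun t ht => ?_
      have : (fun x => D.indicator (fun p : ℝ × ℝ => Ψ p.1) (t, x)) =
          (Icc 0 (u - t)).indicator fun _ => Φ t := by
        ext x
        simp only [hD, hΨ, indicator_apply, mem_ofPred_eq, mem_Icc, if_pos (mem_Icc.1 ht)]
      simp only [this]
      rw [integral_indicator_const _ measurableSet_Icc, smul_eq_mul, Measure.real]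

/-- Let `λ, c, δ > 0`, `α ≥ 0`, let `μ` be a Borel probability
measure supported on `[0,∞)` with `μ({0}) = 0` and continuous distribution function
`F(x) = μ([0,x])`, and let `A : [0,∞) → [0,∞)` be continuous. If `Φ` is continuous on
`[0,∞)`, continuously differentiable on `(0,∞)`, and satisfies for all `u > 0`
`Φ′(u) = ((λ+α)/(c+δu)) Φ(u) − (λ/(c+δu)) ( ∫_{[0,u]} Φ(u−x) dμ(x) + A(u) )`,
then `Φ` satisfies the second-kind Volterra integral equation: for all `u ≥ 0`,
`Φ(u) = cΦ(0)/(c+δu) − (λ/(c+δu)) ∫₀ᵘ A(t) dt + ∫₀ᵘ K_{δ,α}(u,t) Φ(t) dt`, where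
`K_{δ,α}(u,t) = (δ + α + λ(1 − F(u−t)))/(c + δu)`. -/
theorem gerber_shiu_volterra_equation
    (lam c δ α : ℝ) (hlam : 0 < lam) (hc : 0 < c) (hδ : 0 < δ) (hα : 0 ≤ α)
    (μ : Measure ℝ) [IsProbabilityMeasure μ]
    (hμsupp : μ (Iio 0) = 0) (hμ0 : μ {0} = 0)
    (hF : Continuous fun x => (μ (Icc 0 x)).toReal)
    (A : ℝ → ℝ) (hA : ContinuousOn A (Ici 0)) (hApos : ∀ t ∈ Ici (0 : ℝ), 0 ≤ A t)
    (Φ : ℝ → ℝ) (hΦcont : ContinuousOn Φ (Ici 0))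
    (hΦderiv : ContinuousOn (deriv Φ) (Ioi 0))
    (hΦode : ∀ u ∈ Ioi (0 : ℝ),
      HasDerivAt Φ
        (((lam + α) / (c + δ * u)) * Φ u -
          (lam / (c + δ * u)) * ((∫ x in Icc 0 u, Φ (u - x) ∂μ) + A u)) u) :
    ∀ u ∈ Ici (0 : ℝ),
      Φ u = c * Φ 0 / (c + δ * u) -
          (lam / (c + δ * u)) * (∫ t in (0 : ℝ)..u, A t) +
        ∫ t in (0 : ℝ)..u,
          ((δ + α + lam * (1 - (μ (Icc 0 (u - t))).toReal)) / (c + δ * u)) * Φ t := by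
  intro u hu
  have hu : 0 ≤ u := hu
  have hpos : ∀ t, 0 ≤ t → 0 < c + δ * t := fun t ht => by positivity
  have hsub : Icc 0 u ⊆ Ici 0 := Icc_subset_Ici_self
  obtain ⟨hS, hSeq⟩ := integrableOn_and_integral_convolution μ hμsupp (hΦcont.mono hsub)
  set S : ℝ → ℝ := fun s => ∫ x in Icc 0 s, Φ (s - x) ∂μ with hSdef
  have hSi : IntervalIntegrable S volume 0 u :=
    (intervalIntegrable_iff_integrableOn_Icc_of_le hu).2 hS
  have hAi : IntervalIntegrable A volume 0 u :=
    (hA.mono hsub).intervalIntegrable_of_Icc hu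
  have hΦi : IntervalIntegrable Φ volume 0 u :=
    (hΦcont.mono hsub).intervalIntegrable_of_Icc hu
  have hFi : IntervalIntegrable (fun t => (μ (Icc 0 (u - t))).toReal * Φ t) volume 0 u :=
    ((hF.comp (continuous_const.sub continuous_id)).continuousOn.mul
      (hΦcont.mono hsub)).intervalIntegrable_of_Icc hu
  have hSI : ∫ t in (0 : ℝ)..u, S t = ∫ t in (0 : ℝ)..u, (μ (Icc 0 (u - t))).toReal * Φ t := by
    rw [integral_of_le hu, integral_of_le hu, ← integral_Icc_eq_integral_Ioc,
      ← integral_Icc_eq_integral_Ioc, hSeq]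
  have hderiv : ∀ t ∈ Ioo 0 u, HasDerivAt (fun t => (c + δ * t) * Φ t)
      ((δ + lam + α) * Φ t - lam * (S t + A t)) t := by
    intro t ht
    have hlin : HasDerivAt (fun t => c + δ * t) δ t := by
      simpa using ((hasDerivAt_id t).const_mul δ).const_add c
    refine (hlin.mul (hΦode t ht.1)).congr_deriv ?_
    have := (hpos t ht.1.le).ne'
    simp only [hSdef]
    field_simp
    ring
  have hftc := integral_eq_sub_of_hasDerivAt_of_le hu
    (((continuous_const.add (continuous_const.mul continuous_id)).continuousOn).mul
      (hΦcont.mono hsub)) hderiv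
    ((hΦi.const_mul _).sub ((hSi.add hAi).const_mul _))
  rw [intervalIntegral.integral_sub (hΦi.const_mul _) ((hSi.add hAi).const_mul _),
    intervalIntegral.integral_const_mul, intervalIntegral.integral_const_mul,
    intervalIntegral.integral_add hSi hAi, hSI] at hftc
  have hK : ∫ t in (0 : ℝ)..u,
      ((δ + α + lam * (1 - (μ (Icc 0 (u - t))).toReal)) / (c + δ * u)) * Φ t =
      (c + δ * u)⁻¹ * ((δ + lam + α) * (∫ t in (0 : ℝ)..u, Φ t) -
        lam * ∫ t in (0 : ℝ)..u, (μ (Icc 0 (u - t))).toReal * Φ t) := by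
    rw [← intervalIntegral.integral_const_mul, ← intervalIntegral.integral_const_mul,
      ← intervalIntegral.integral_sub (hΦi.const_mul _) (hFi.const_mul _),
      ← intervalIntegral.integral_const_mul]
    congr 1
    ext t
    ring
  rw [hK]
  have := (hpos u hu).ne'
  field_simp
  simp only [Pi.mul_apply, Pi.add_apply, id, mul_zero, add_zero] at hftc
  linear_combination -hftc
end
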